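/- Let (A,[·,·]1,∘1) be a finite-dimensional Malcev-Poisson algebra over a field K of characteristic 0 and suppose the dual space A* carries a Malcev-Poisson algebra structure ([·,·]2,∘2). Define ad*_A : A → End(A*) by (ad*_A(x)ξ)(y) = −ξ([x,y]1), −L* : A → End(A*) by ((−L*)(x)ξ)(y) = ξ(x∘1 y), and analogously ad*_{A*} : A* → End(A) by ⟨ad*_{A*}(ξ)x, η⟩ = −⟨x,[ξ,η]2⟩ and −L*_{A*} : A* → End(A) by ⟨(−L*_{A*})(ξ)x, η⟩ = ⟨x, ξ∘2 η⟩ (with ⟨x,η⟩ = η(x)). Then the following are equivalent: (i) there exists a Malcev-Poisson algebra structure on A ⊕ A* whose restrictions to A and to A* are the given structures (so A and A* are subalgebras), and for which the bilinear form ω_d(x+ξ, y+η) = η(x) + ξ(y) satisfies ω_d(u∘v, w) = ω_d(u, v∘w) and ω_d([u,v], w) = ω_d(u, [v,w]) for all u,v,w ∈ A ⊕ A*; (ii) (A, A*, ad*_A, −L*, ad*_{A*}, −L*_{A*}) is a matched pair of Malcev-Poisson algebras. -/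

import Mathlib

open scoped TensorProduct

namespace MPA

variable (K : Type*) [Field K] [CharZero K]

section Basic
variable {A B V : Type*}
variable [AddCommGroup A] [Module K A] [AddCommGroup B] [Module K B]
variable [AddCommGroup V] [Module K V]

/-- A two-argument map is bilinear. -/
def IsBilin (m : A → A → B) : Prop :=
  (∀ x : A, IsLinearMap K (m x)) ∧ (∀ y : A, IsLinearMap K fun x => m x y)

/-- Bundle a bilinear two-argument map. -/
def mkBilin (m : A → A → B) (h : IsBilin K m) : A →ₗ[K] A →ₗ[K] B :=
  LinearMap.mk₂ K m (fun x y z => (h.2 z).map_add x y) (fun c x y => (h.2 y).map_smul c x)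
    (fun x y z => (h.1 x).map_add y z) (fun c x y => (h.1 x).map_smul c y)

/-- Bundle the left multiplications of a bilinear map as endomorphisms. -/
def mkEnd (m : A → A → A) (h : IsBilin K m) : A → Module.End K A :=
  fun x => IsLinearMap.mk' (m x) (h.1 x)

/-- The Jacobian `J(x,y,z) = [[x,y],z] + [[z,x],y] + [[y,z],x]`. -/
def Jacobian (br : A → A → A) (x y z : A) : A :=
  br (br x y) z + br (br z x) y + br (br y z) x

/-- Antisymmetry. -/
def IsSkew (br : A → A → A) : Prop := ∀ x y, br x y = - br y x

/-- Sagle's identity. -/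
def SagleIdentity (br : A → A → A) : Prop :=
  ∀ x y z t, br (br x z) (br y t) =
    br (br (br x y) z) t + br (br (br y z) t) x + br (br (br z t) x) y + br (br (br t x) y) z

/-- A Malcev algebra structure: an antisymmetric bilinear bracket satisfying Sagle's identity. -/
def IsMalcev (br : A → A → A) : Prop :=
  IsBilin K br ∧ IsSkew br ∧ SagleIdentity br

/-- A commutative associative algebra structure given by a bilinear product. -/
def IsCommAssoc (m : A → A → A) : Prop :=
  IsBilin K m ∧ (∀ x y, m x y = m y x) ∧ ∀ x y z, m (m x y) z = m x (m y z)

/-- A Malcev-Poisson algebra: a Malcev bracket and a commutative associative product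
satisfying the Leibniz rule. -/
def IsMalcevPoisson (br m : A → A → A) : Prop :=
  IsMalcev K br ∧ IsCommAssoc K m ∧
    ∀ x y z, br x (m y z) = m (br x y) z + m y (br x z)

/-- The defining identity of a representation of a Malcev algebra. -/
def IsMalcevRepMap (br : A → A → A) (ρ : A → Module.End K V) : Prop :=
  ∀ x y z, ρ (br (br x y) z) =
    ρ z * ρ y * ρ x - ρ y * ρ x * ρ z + ρ x * ρ (br y z) + ρ (br x z) * ρ y

/-- A representation of a Malcev algebra. -/
def IsMalcevRep (br : A → A → A) (ρ : A → Module.End K V) : Prop :=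
  IsLinearMap K ρ ∧ IsMalcevRepMap K br ρ

/-- A representation of a (commutative) associative algebra. -/
def IsAssocRep (m : A → A → A) (μ : A → Module.End K V) : Prop :=
  IsLinearMap K μ ∧ ∀ x y, μ (m x y) = μ x * μ y

/-- A representation of a Malcev-Poisson algebra. -/
def IsMPRep (br m : A → A → A) (ρ μ : A → Module.End K V) : Prop :=
  IsMalcevRep K br ρ ∧ IsAssocRep K m μ ∧
  (∀ x y, ρ (m x y) = μ y * ρ x + μ x * ρ y) ∧
  (∀ x y, μ (br x y) = ρ x * μ y - μ y * ρ x)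

/-- An `A`-module Malcev algebra. -/
def IsModuleMalcevAlg (br : A → A → A) (brV : V → V → V) (ρ : A → Module.End K V) : Prop :=
  IsMalcev K brV ∧ IsMalcevRep K br ρ ∧
  (∀ x y a b, ρ (br x y) (brV a b) =
      ρ x (brV (ρ y a) b) - brV (ρ y (ρ x a)) b - brV (ρ x (ρ y b)) a + ρ y (brV (ρ x b) a)) ∧
  (∀ x y a b, brV (ρ x a) (ρ y b) =
      brV (ρ (br x y) a) b - ρ x (brV (ρ y a) b) + ρ y (ρ x (brV a b)) + brV (ρ y (ρ x b)) a) ∧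
  (∀ x a b c, brV (ρ x a) (brV b c) =
      brV (brV (ρ x b) a) c - ρ x (brV (brV b a) c) - brV (ρ x (brV a c)) b - brV (brV (ρ x c) b) a)

/-- An `A`-module associative algebra. -/
def IsModuleAssocAlg (m : A → A → A) (mV : V → V → V) (μ : A → Module.End K V) : Prop :=
  IsCommAssoc K mV ∧ IsAssocRep K m μ ∧ ∀ x a b, μ x (mV a b) = mV (μ x a) b

/-- An `A`-module Malcev-Poisson algebra. -/
def IsModuleMP (br m : A → A → A) (brV mV : V → V → V) (ρ μ : A → Module.End K V) : Prop :=
  IsModuleMalcevAlg K br brV ρ ∧ IsModuleAssocAlg K m mV μ ∧ IsMPRep K br m ρ μ ∧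
  (∀ x a b, ρ x (mV a b) = mV (ρ x a) b + mV a (ρ x b)) ∧
  (∀ x a b, brV a (μ x b) = - mV (ρ x a) b + μ x (brV a b))

/-- The sub-adjacent bracket `{x,y} = x◇y − y◇x + [x,y]` of a post-Malcev algebra. -/
def pmBr (br dia : A → A → A) : A → A → A := fun x y => dia x y - dia y x + br x y

/-- The associated product `x∘y = x▷y + y▷x + x·y` of a commutative dendriform trialgebra. -/
def trialMul (mdot tri : A → A → A) : A → A → A := fun x y => tri x y + tri y x + mdot x y

/-- A post-Malcev algebra. -/
def IsPostMalcev (br dia : A → A → A) : Prop :=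
  IsMalcev K br ∧ IsBilin K dia ∧
  (∀ x y z t, dia (pmBr br dia x z) (br y t) =
      dia x (br (dia z y) t) - br (dia z (dia x y)) t - br (dia x (dia z t)) y
        + dia z (br (dia x t) y)) ∧
  (∀ x y z t, br (dia x z) (dia y t) =
      br (dia (pmBr br dia x y) z) t - dia x (br (dia y z) t) + dia y (dia x (br z t))
        + br (dia y (dia x t)) z) ∧
  (∀ x y z t, br (dia x z) (br y t) =
      br (br (dia x y) z) t - dia x (br (br y z) t) - br (dia x (br z t)) y
        - br (br (dia x t) y) z) ∧
  (∀ x y z t, dia (pmBr br dia y z) (dia x t) =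
      dia (pmBr br dia (pmBr br dia x y) z) t + dia y (dia (pmBr br dia x z) t)
        + dia x (dia y (dia z t)) - dia z (dia x (dia y t)))

/-- A commutative dendriform trialgebra. -/
def IsCommTridend (mdot tri : A → A → A) : Prop :=
  IsCommAssoc K mdot ∧ IsBilin K tri ∧
  (∀ x y z, tri (trialMul mdot tri x y) z = tri x (tri y z)) ∧
  (∀ x y z, mdot (tri x y) z = tri x (mdot y z))

/-- A post-Malcev-Poisson algebra. -/
def IsPostMP (br dia mdot tri : A → A → A) : Prop :=
  IsMalcevPoisson K br mdot ∧ IsPostMalcev K br dia ∧ IsCommTridend K mdot tri ∧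
  (∀ x y z, dia x (mdot y z) = mdot (dia x y) z + mdot y (dia x z)) ∧
  (∀ x y z, br x (tri z y) = tri z (br x y) - mdot y (dia z x)) ∧
  (∀ x y z, dia (trialMul mdot tri y z) x = tri z (dia y x) + tri y (dia z x)) ∧
  (∀ x y z, tri (pmBr br dia x z) y = dia x (tri z y) - tri z (dia x y))

/-- The dual representation `ρ*(x) = −ρ(x)*`. -/
def dualRepNeg (ρ : A → Module.End K V) : A → Module.End K (Module.Dual K V) :=
  fun x => -(ρ x).dualMap

/-- The dual map `x ↦ μ(x)*` (used for `−μ*`). -/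
def dualRepPos (μ : A → Module.End K V) : A → Module.End K (Module.Dual K V) :=
  fun x => (μ x).dualMap

end Basic

section Matched
variable {A1 A2 : Type*} [AddCommGroup A1] [Module K A1] [AddCommGroup A2] [Module K A2]

/-- Identities (M1), (M3), (M5) of a matched pair of Malcev algebras. -/
def MalcevCompatHalf (br1 : A1 → A1 → A1) (br2 : A2 → A2 → A2)
    (ρ1 : A1 → Module.End K A2) (ρ2 : A2 → Module.End K A1) : Prop :=
  (∀ (x1 y1 z1 : A1) (x2 : A2),
      br1 (br1 (ρ2 x2 x1) y1) z1 - br1 (ρ2 x2 (br1 y1 z1)) x1 - br1 (ρ2 (ρ1 x1 x2) y1) z1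
      - br1 (br1 (ρ2 x2 z1) x1) y1 + ρ2 (ρ1 y1 (ρ1 x1 x2)) z1 + br1 (br1 x1 z1) (ρ2 x2 y1)
      - ρ2 x2 (br1 (br1 x1 y1) z1) + ρ2 (ρ1 y1 x2) (br1 x1 z1) + br1 (ρ2 (ρ1 z1 x2) x1) y1
      + ρ2 (ρ1 (br1 y1 z1) x2) x1 - ρ2 (ρ1 x1 (ρ1 z1 x2)) y1 = 0) ∧
  (∀ (x1 y1 : A1) (x2 y2 : A2),
      ρ2 (ρ1 x1 (br2 x2 y2)) y1 - ρ2 (ρ1 x1 x2) (ρ2 y2 y1) + ρ2 x2 (br1 (ρ2 y2 x1) y1)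
      - br1 (ρ2 y2 (ρ2 x2 y1)) x1 - br1 (ρ2 (br2 x2 y2) x1) y1 + ρ2 (ρ1 y1 y2) (ρ2 x2 x1)
      - ρ2 (br2 (ρ1 y1 x2) y2) x1 - ρ2 y2 (ρ2 x2 (br1 x1 y1)) + br1 (ρ2 x2 x1) (ρ2 y2 y1)
      - ρ2 x2 (ρ2 (ρ1 x1 y2) y1) + ρ2 (ρ1 (ρ2 x2 y1) y2) x1 = 0) ∧
  (∀ (x1 y1 : A1) (x2 y2 : A2),
      ρ2 x2 (br1 (ρ2 y2 y1) x1) - ρ2 (br2 (ρ1 x1 y2) x2) y1 - br1 (ρ2 x2 (ρ2 y2 x1)) y1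
      + ρ2 y2 (br1 (ρ2 x2 x1) y1) - br1 (ρ2 y2 (ρ2 x2 y1)) x1 - ρ2 (br2 (ρ1 y1 x2) y2) x1
      - ρ2 y2 (ρ2 (ρ1 x1 x2) y1) - ρ2 x2 (ρ2 (ρ1 y1 y2) x1) + ρ2 (br2 x2 y2) (br1 x1 y1)
      + ρ2 (ρ1 (ρ2 x2 y1) y2) x1 + ρ2 (ρ1 (ρ2 y2 x1) x2) y1 = 0)

/-- A matched pair of Malcev algebras. -/
def IsMatchedPairMalcev (br1 : A1 → A1 → A1) (br2 : A2 → A2 → A2)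
    (ρ1 : A1 → Module.End K A2) (ρ2 : A2 → Module.End K A1) : Prop :=
  IsMalcev K br1 ∧ IsMalcev K br2 ∧ IsMalcevRep K br1 ρ1 ∧ IsMalcevRep K br2 ρ2 ∧
  MalcevCompatHalf K br1 br2 ρ1 ρ2 ∧ MalcevCompatHalf K br2 br1 ρ2 ρ1

/-- A matched pair of commutative associative algebras. -/
def IsMatchedPairComm (m1 : A1 → A1 → A1) (m2 : A2 → A2 → A2)
    (μ1 : A1 → Module.End K A2) (μ2 : A2 → Module.End K A1) : Prop :=
  IsCommAssoc K m1 ∧ IsCommAssoc K m2 ∧ IsAssocRep K m1 μ1 ∧ IsAssocRep K m2 μ2 ∧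
  (∀ (x1 : A1) (x2 y2 : A2), μ1 x1 (m2 x2 y2) = m2 (μ1 x1 x2) y2 + μ1 (μ2 x2 x1) y2) ∧
  (∀ (x2 : A2) (x1 y1 : A1), μ2 x2 (m1 x1 y1) = m1 (μ2 x2 x1) y1 + μ2 (μ1 x1 x2) y1)

/-- A matched pair of Malcev-Poisson algebras. -/
def IsMatchedPairMP (br1 m1 : A1 → A1 → A1) (br2 m2 : A2 → A2 → A2)
    (ρ1 μ1 : A1 → Module.End K A2) (ρ2 μ2 : A2 → Module.End K A1) : Prop :=
  IsMatchedPairMalcev K br1 br2 ρ1 ρ2 ∧ IsMatchedPairComm K m1 m2 μ1 μ2 ∧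
  IsMPRep K br1 m1 ρ1 μ1 ∧ IsMPRep K br2 m2 ρ2 μ2 ∧
  (∀ (x2 : A2) (x1 y1 : A1),
      ρ2 x2 (m1 x1 y1) =
        m1 (ρ2 x2 x1) y1 + m1 x1 (ρ2 x2 y1) - μ2 (ρ1 x1 x2) y1 - μ2 (ρ1 y1 x2) x1) ∧
  (∀ (x1 : A1) (x2 y2 : A2),
      ρ1 x1 (m2 x2 y2) =
        m2 (ρ1 x1 x2) y2 + m2 x2 (ρ1 x1 y2) - μ1 (ρ2 x2 x1) y2 - μ1 (ρ2 y2 x1) x2) ∧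
  (∀ (x1 y1 : A1) (x2 : A2),
      br1 x1 (μ2 x2 y1) - ρ2 (μ1 y1 x2) x1 =
        μ2 (ρ1 x1 x2) y1 - m1 (ρ2 x2 x1) y1 + μ2 x2 (br1 x1 y1)) ∧
  (∀ (x2 y2 : A2) (x1 : A1),
      br2 x2 (μ1 x1 y2) - ρ1 (μ2 y2 x1) x2 =
        μ1 (ρ2 x2 x1) y2 - m2 (ρ1 x1 x2) y2 + μ1 x1 (br2 x2 y2))

/-- The bracket on the direct sum of a (candidate) matched pair. -/
def prodBr (br1 : A1 → A1 → A1) (br2 : A2 → A2 → A2)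
    (ρ1 : A1 → Module.End K A2) (ρ2 : A2 → Module.End K A1) :
    A1 × A2 → A1 × A2 → A1 × A2 :=
  fun p q => (br1 p.1 q.1 + ρ2 p.2 q.1 - ρ2 q.2 p.1, br2 p.2 q.2 + ρ1 p.1 q.2 - ρ1 q.1 p.2)

/-- The product on the direct sum of a (candidate) matched pair. -/
def prodMul (m1 : A1 → A1 → A1) (m2 : A2 → A2 → A2)
    (μ1 : A1 → Module.End K A2) (μ2 : A2 → Module.End K A1) :
    A1 × A2 → A1 × A2 → A1 × A2 :=
  fun p q => (m1 p.1 q.1 + μ2 p.2 q.1 + μ2 q.2 p.1, m2 p.2 q.2 + μ1 p.1 q.2 + μ1 q.1 p.2)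

end Matched

section Tensor
variable {A : Type*} [AddCommGroup A] [Module K A]

/-- The binary operation on the dual space induced by a comultiplication:
`⟨x, op(ξ,η)⟩ = ⟨δ(x), ξ⊗η⟩`. -/
noncomputable def dualOp (δ : A →ₗ[K] A ⊗[K] A) :
    Module.Dual K A → Module.Dual K A → Module.Dual K A :=
  fun ξ η => TensorProduct.lift (ξ.smulRight η) ∘ₗ δ

/-- The cyclic permutation `σ(x⊗y⊗z⊗t) = y⊗z⊗t⊗x`. -/
noncomputable def cyc4 : (((A ⊗[K] A) ⊗[K] A) ⊗[K] A) →ₗ[K] (((A ⊗[K] A) ⊗[K] A) ⊗[K] A) :=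
  (TensorProduct.comm K A ((A ⊗[K] A) ⊗[K] A)).toLinearMap ∘ₗ
    (TensorProduct.assoc K A (A ⊗[K] A) A).toLinearMap ∘ₗ
      (TensorProduct.congr (TensorProduct.assoc K A A A) (LinearEquiv.refl K A)).toLinearMap

/-- A Malcev coalgebra. -/
noncomputable def IsMalcevCoalg (δ : A →ₗ[K] A ⊗[K] A) : Prop :=
  ((TensorProduct.comm K A A).toLinearMap ∘ₗ δ = -δ) ∧
  ((TensorProduct.assoc K (A ⊗[K] A) A A).symm.toLinearMap ∘ₗ TensorProduct.map δ δ ∘ₗ δ =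
    (LinearMap.id + cyc4 K + cyc4 K ∘ₗ cyc4 K + cyc4 K ∘ₗ cyc4 K ∘ₗ cyc4 K) ∘ₗ
      TensorProduct.map (TensorProduct.map δ LinearMap.id) LinearMap.id ∘ₗ
        TensorProduct.map δ LinearMap.id ∘ₗ δ)

/-- A cocommutative coassociative coalgebra. -/
def IsCoCommCoassoc (Δ : A →ₗ[K] A ⊗[K] A) : Prop :=
  ((TensorProduct.comm K A A).toLinearMap ∘ₗ Δ = Δ) ∧
  (TensorProduct.map LinearMap.id Δ ∘ₗ Δ =
    (TensorProduct.assoc K A A A).toLinearMap ∘ₗ TensorProduct.map Δ LinearMap.id ∘ₗ Δ)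

/-- A Malcev-Poisson coalgebra. -/
noncomputable def IsMPCoalg (Δ δ : A →ₗ[K] A ⊗[K] A) : Prop :=
  IsCoCommCoassoc K Δ ∧ IsMalcevCoalg K δ ∧
  TensorProduct.map LinearMap.id Δ ∘ₗ δ
    - (TensorProduct.assoc K A A A).toLinearMap ∘ₗ TensorProduct.map δ LinearMap.id ∘ₗ Δ
    - (TensorProduct.leftComm K A A A).toLinearMap ∘ₗ TensorProduct.map LinearMap.id δ ∘ₗ Δ = 0

/-- The bracket as a linear map on the tensor square. -/
noncomputable def brTensor (br : A → A → A) (h : IsBilin K br) : A ⊗[K] A →ₗ[K] A :=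
  TensorProduct.lift (mkBilin K br h)

/-- `(id⊗m⊗id)(id⊗τ⊗id) : (a⊗b)⊗(c⊗d) ↦ a⊗([c,b]⊗d)`. -/
noncomputable def mixA (br : A → A → A) (h : IsBilin K br) :
    (A ⊗[K] A) ⊗[K] (A ⊗[K] A) →ₗ[K] A ⊗[K] (A ⊗[K] A) :=
  TensorProduct.map LinearMap.id (TensorProduct.map (brTensor K br h) LinearMap.id) ∘ₗ
    TensorProduct.map LinearMap.id (TensorProduct.assoc K A A A).symm.toLinearMap ∘ₗ
      TensorProduct.map LinearMap.id (TensorProduct.leftComm K A A A).toLinearMap ∘ₗ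
        (TensorProduct.assoc K A A (A ⊗[K] A)).toLinearMap

/-- `(id⊗id⊗m)(id⊗τ⊗id) : (a⊗b)⊗(c⊗d) ↦ a⊗(c⊗[b,d])`. -/
noncomputable def mixB (br : A → A → A) (h : IsBilin K br) :
    (A ⊗[K] A) ⊗[K] (A ⊗[K] A) →ₗ[K] A ⊗[K] (A ⊗[K] A) :=
  TensorProduct.map LinearMap.id (TensorProduct.map LinearMap.id (brTensor K br h)) ∘ₗ
    TensorProduct.map LinearMap.id (TensorProduct.leftComm K A A A).toLinearMap ∘ₗ
      (TensorProduct.assoc K A A (A ⊗[K] A)).toLinearMap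

/-- Compatibility condition (B1) of a Malcev bialgebra. -/
def MalcevBialgB1 (br : A → A → A) (h : IsBilin K br) (δ : A →ₗ[K] A ⊗[K] A) : Prop :=
  ∀ x y z : A,
    δ (br (br x y) z)
      + TensorProduct.map LinearMap.id (mkEnd K br h x) (δ (br y z))
      + TensorProduct.map (mkEnd K br h y) LinearMap.id (δ (br x z))
    = TensorProduct.map (mkEnd K br h (br z y)) LinearMap.id (δ x)
      + TensorProduct.map (mkEnd K br h z) (mkEnd K br h y) (δ x)
      + TensorProduct.map LinearMap.id (mkEnd K br h z ∘ₗ mkEnd K br h y) (δ x)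
      - TensorProduct.map (mkEnd K br h z ∘ₗ mkEnd K br h x) LinearMap.id (δ y)
      - TensorProduct.map (mkEnd K br h x) (mkEnd K br h z) (δ y)
      + TensorProduct.map LinearMap.id (mkEnd K br h (br x z)) (δ y)
      + TensorProduct.map (mkEnd K br h x ∘ₗ mkEnd K br h y) LinearMap.id (δ z)
      - TensorProduct.map LinearMap.id (mkEnd K br h y ∘ₗ mkEnd K br h x) (δ z)

/-- Compatibility condition (B2) of a Malcev bialgebra. -/
noncomputable def MalcevBialgB2 (br : A → A → A) (h : IsBilin K br) (δ : A →ₗ[K] A ⊗[K] A) :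
    Prop :=
  ∀ x y : A,
    TensorProduct.map LinearMap.id δ (δ (br x y))
    = TensorProduct.map LinearMap.id (TensorProduct.map LinearMap.id (mkEnd K br h x))
        (TensorProduct.map LinearMap.id δ (δ y))
      + (TensorProduct.assoc K A A A).toLinearMap
          (TensorProduct.map δ LinearMap.id (TensorProduct.map (mkEnd K br h x) LinearMap.id (δ y)))
      + mixA K br h (δ y ⊗ₜ[K] δ x)
      - TensorProduct.map (mkEnd K br h y) LinearMap.id
          ((TensorProduct.assoc K A A A).toLinearMap (TensorProduct.map δ LinearMap.id (δ x)))
      - TensorProduct.map LinearMap.id (TensorProduct.map LinearMap.id (mkEnd K br h y))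
          ((TensorProduct.assoc K A A A).toLinearMap (TensorProduct.map δ LinearMap.id (δ x)))
      + mixB K br h (δ x ⊗ₜ[K] δ y)
      - TensorProduct.map LinearMap.id (TensorProduct.comm K A A).toLinearMap
          (TensorProduct.map LinearMap.id (TensorProduct.map LinearMap.id (mkEnd K br h x))
            ((TensorProduct.assoc K A A A).toLinearMap (TensorProduct.map δ LinearMap.id (δ y))))
      + TensorProduct.map LinearMap.id (TensorProduct.comm K A A).toLinearMap
          ((TensorProduct.assoc K A A A).toLinearMap
            (TensorProduct.map δ LinearMap.id (TensorProduct.map (mkEnd K br h y) LinearMap.id (δ x))))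
      - TensorProduct.map LinearMap.id (TensorProduct.map (mkEnd K br h y) LinearMap.id)
          (TensorProduct.map LinearMap.id δ (δ x))
      + TensorProduct.map LinearMap.id (TensorProduct.comm K A A).toLinearMap
          (TensorProduct.map (mkEnd K br h x) LinearMap.id
            ((TensorProduct.assoc K A A A).toLinearMap (TensorProduct.map δ LinearMap.id (δ y))))

end Tensor

section Coadj
variable {A : Type*} [AddCommGroup A] [Module K A] [Module.IsReflexive K A]

/-- The coadjoint-type action of a bracket on the dual space, transported back to `A`
through the canonical isomorphism `A ≃ A**`:
`⟨coadjDouble(ξ)x, η⟩ = −⟨x, [ξ,η]*⟩`. -/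
noncomputable def coadjDouble (brS : Module.Dual K A → Module.Dual K A → Module.Dual K A)
    (h : IsBilin K brS) : Module.Dual K A → Module.End K A :=
  fun ξ => -((Module.evalEquiv K A).symm.toLinearMap ∘ₗ
      (IsLinearMap.mk' (brS ξ) (h.1 ξ)).dualMap ∘ₗ (Module.evalEquiv K A).toLinearMap)

/-- `⟨comulDouble(ξ)x, η⟩ = ⟨x, ξ∘η⟩` : the action `−L*` of the dual product, transported
back to `A` through `A ≃ A**`. -/
noncomputable def comulDouble (mS : Module.Dual K A → Module.Dual K A → Module.Dual K A)
    (h : IsBilin K mS) : Module.Dual K A → Module.End K A :=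
  fun ξ => (Module.evalEquiv K A).symm.toLinearMap ∘ₗ
      (IsLinearMap.mk' (mS ξ) (h.1 ξ)).dualMap ∘ₗ (Module.evalEquiv K A).toLinearMap

end Coadj

section Bilinear
variable {F : Type*} [Field F] {A B : Type*}
  [AddCommGroup A] [Module F A] [AddCommGroup B] [Module F B]

theorem IsBilin.add_left {m : A → A → B} (h : IsBilin F m) (x y z : A) :
    m (x + y) z = m x z + m y z := (h.2 z).map_add x y

theorem IsBilin.add_right {m : A → A → B} (h : IsBilin F m) (x y z : A) :
    m x (y + z) = m x y + m x z := (h.1 x).map_add y z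

theorem IsBilin.neg_left {m : A → A → B} (h : IsBilin F m) (x y : A) :
    m (-x) y = -m x y := (h.2 y).map_neg x

end Bilinear

section Sagle
variable {F : Type*} [Field F] {A : Type*} [AddCommGroup A] [Module F A]

/-- The difference of the two sides of Sagle's identity. -/
def sagleDefect (br : A → A → A) (x y z t : A) : A :=
  br (br (br x y) z) t + br (br (br y z) t) x + br (br (br z t) x) y + br (br (br t x) y) z
    - br (br x z) (br y t)

theorem sagleIdentity_iff_sagleDefect {br : A → A → A} :
    SagleIdentity br ↔ ∀ x y z t, sagleDefect br x y z t = 0 := by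
  simp only [SagleIdentity, sagleDefect, sub_eq_zero, eq_comm]

theorem sagleDefect_rotate {br : A → A → A} (hb : IsBilin F br) (hs : IsSkew br) (x y z t : A) :
    sagleDefect br y z t x = sagleDefect br x y z t := by
  have h : br (br y t) (br z x) = br (br x z) (br y t) := by
    rw [hs (br y t), hs z x, hb.neg_left, neg_neg]
  simp only [sagleDefect, h]
  abel

theorem sagleDefect_add {br : A → A → A} (hb : IsBilin F br) (x x' y z t : A) :
    sagleDefect br (x + x') y z t = sagleDefect br x y z t + sagleDefect br x' y z t := by
  simp only [sagleDefect, hb.add_left, hb.add_right]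
  abel

end Sagle

section DirectSum
variable {F : Type*} [Field F] {A1 A2 : Type*}
  [AddCommGroup A1] [Module F A1] [AddCommGroup A2] [Module F A2]

/-- On a direct sum, Sagle's identity only has to be checked on arguments lying in the summands,
and only up to cyclic permutation. -/
theorem sagleIdentity_prod {Br : A1 × A2 → A1 × A2 → A1 × A2} (hb : IsBilin F Br)
    (hs : IsSkew Br)
    (h₄₀ : ∀ x y z t : A1, sagleDefect Br (x, 0) (y, 0) (z, 0) (t, 0) = 0)
    (h₃₁ : ∀ (x y z : A1) (t : A2), sagleDefect Br (x, 0) (y, 0) (z, 0) (0, t) = 0)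
    (h₂₂ : ∀ (x y : A1) (z t : A2), sagleDefect Br (x, 0) (y, 0) (0, z) (0, t) = 0)
    (h₂₂' : ∀ (x y : A1) (z t : A2), sagleDefect Br (x, 0) (0, z) (y, 0) (0, t) = 0)
    (h₁₃ : ∀ (x : A1) (y z t : A2), sagleDefect Br (x, 0) (0, y) (0, z) (0, t) = 0)
    (h₀₄ : ∀ x y z t : A2, sagleDefect Br (0, x) (0, y) (0, z) (0, t) = 0) :
    SagleIdentity Br := by
  have rot := sagleDefect_rotate hb hs
  have split : ∀ {y z t : A1 × A2}, (∀ x, sagleDefect Br (x, 0) y z t = 0) →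
      (∀ x, sagleDefect Br (0, x) y z t = 0) → ∀ x, sagleDefect Br x y z t = 0 := by
    intro y z t h h' x
    rw [← Prod.fst_add_snd x, sagleDefect_add hb, h, h', add_zero]
  refine sagleIdentity_iff_sagleDefect.2 fun x y z t => ?_
  refine split (fun x => ?_) (fun x => ?_) x <;> rw [← rot] <;>
  refine split (fun y => ?_) (fun y => ?_) y <;> rw [← rot] <;>
  refine split (fun z => ?_) (fun z => ?_) z <;> rw [← rot] <;>
  refine split (fun t => ?_) (fun t => ?_) t
  all_goals solve
    | simp only [h₄₀, h₃₁, h₂₂, h₂₂', h₁₃, h₀₄]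
    | rw [← rot]; simp only [h₃₁, h₂₂, h₂₂', h₁₃]
    | rw [← rot, ← rot]; simp only [h₃₁, h₂₂, h₁₃]
    | rw [← rot, ← rot, ← rot]; simp only [h₃₁, h₂₂, h₁₃]

/-- On a direct sum, associativity of a commutative product only has to be checked on
arguments lying in the summands, with the last factor possibly in the other summand. -/
theorem assoc_prod {Mul : A1 × A2 → A1 × A2 → A1 × A2} (hb : IsBilin F Mul)
    (hc : ∀ u v, Mul u v = Mul v u)
    (h₃₀ : ∀ x y z : A1, Mul (Mul (x, 0) (y, 0)) (z, 0) = Mul (x, 0) (Mul (y, 0) (z, 0)))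
    (h₂₁ : ∀ (x y : A1) (z : A2),
      Mul (Mul (x, 0) (y, 0)) (0, z) = Mul (x, 0) (Mul (y, 0) (0, z)))
    (h₁₂ : ∀ (x y : A2) (z : A1),
      Mul (Mul (0, x) (0, y)) (z, 0) = Mul (0, x) (Mul (0, y) (z, 0)))
    (h₀₃ : ∀ x y z : A2, Mul (Mul (0, x) (0, y)) (0, z) = Mul (0, x) (Mul (0, y) (0, z)))
    (u v w : A1 × A2) : Mul (Mul u v) w = Mul u (Mul v w) := by
  rw [← Prod.fst_add_snd u, ← Prod.fst_add_snd v, ← Prod.fst_add_snd w]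
  have left₁ : ∀ (x : A2) (y z : A1),
      Mul (Mul (0, x) (y, 0)) (z, 0) = Mul (0, x) (Mul (y, 0) (z, 0)) := fun x y z => by
    rw [hc (0, x) (y, 0), hc (0, x), hc _ (z, 0), hc (y, 0) (z, 0), h₂₁]
  have left₂ : ∀ (x : A1) (y z : A2),
      Mul (Mul (x, 0) (0, y)) (0, z) = Mul (x, 0) (Mul (0, y) (0, z)) := fun x y z => by
    rw [hc (x, 0) (0, y), hc (x, 0), hc _ (0, z), hc (0, y) (0, z), h₁₂]
  have mid₁ : ∀ (x z : A1) (y : A2),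
      Mul (Mul (x, 0) (0, y)) (z, 0) = Mul (x, 0) (Mul (0, y) (z, 0)) := fun x z y => by
    rw [hc _ (z, 0), ← h₂₁, hc (0, y), ← h₂₁, hc (z, 0)]
  have mid₂ : ∀ (x z : A2) (y : A1),
      Mul (Mul (0, x) (y, 0)) (0, z) = Mul (0, x) (Mul (y, 0) (0, z)) := fun x z y => by
    rw [hc _ (0, z), ← h₁₂, hc (y, 0), ← h₁₂, hc (0, z)]
  simp only [hb.add_left, hb.add_right, h₃₀, h₂₁, h₁₂, h₀₃, left₁, left₂, mid₁, mid₂]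

/-- On a direct sum, the Leibniz rule only has to be checked on arguments lying in the summands,
up to exchanging the two factors. -/
theorem leibniz_prod {Br Mul : A1 × A2 → A1 × A2 → A1 × A2} (hb : IsBilin F Br)
    (hm : IsBilin F Mul) (hc : ∀ u v, Mul u v = Mul v u)
    (h₁₁₁ : ∀ x y z : A1, Br (x, 0) (Mul (y, 0) (z, 0)) =
      Mul (Br (x, 0) (y, 0)) (z, 0) + Mul (y, 0) (Br (x, 0) (z, 0)))
    (h₂₁₁ : ∀ (x : A2) (y z : A1), Br (0, x) (Mul (y, 0) (z, 0)) =
      Mul (Br (0, x) (y, 0)) (z, 0) + Mul (y, 0) (Br (0, x) (z, 0)))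
    (h₁₁₂ : ∀ (x y : A1) (z : A2), Br (x, 0) (Mul (y, 0) (0, z)) =
      Mul (Br (x, 0) (y, 0)) (0, z) + Mul (y, 0) (Br (x, 0) (0, z)))
    (h₁₂₂ : ∀ (x : A1) (y z : A2), Br (x, 0) (Mul (0, y) (0, z)) =
      Mul (Br (x, 0) (0, y)) (0, z) + Mul (0, y) (Br (x, 0) (0, z)))
    (h₂₂₁ : ∀ (x y : A2) (z : A1), Br (0, x) (Mul (0, y) (z, 0)) =
      Mul (Br (0, x) (0, y)) (z, 0) + Mul (0, y) (Br (0, x) (z, 0)))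
    (h₂₂₂ : ∀ x y z : A2, Br (0, x) (Mul (0, y) (0, z)) =
      Mul (Br (0, x) (0, y)) (0, z) + Mul (0, y) (Br (0, x) (0, z)))
    (u v w : A1 × A2) : Br u (Mul v w) = Mul (Br u v) w + Mul v (Br u w) := by
  rw [← Prod.fst_add_snd u, ← Prod.fst_add_snd v, ← Prod.fst_add_snd w]
  have h₁₂₁ : ∀ (x z : A1) (y : A2), Br (x, 0) (Mul (0, y) (z, 0)) =
      Mul (Br (x, 0) (0, y)) (z, 0) + Mul (0, y) (Br (x, 0) (z, 0)) := fun x z y => by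
    rw [hc (0, y), h₁₁₂, hc (z, 0), hc (0, y), add_comm]
  have h₂₁₂ : ∀ (x z : A2) (y : A1), Br (0, x) (Mul (y, 0) (0, z)) =
      Mul (Br (0, x) (y, 0)) (0, z) + Mul (y, 0) (Br (0, x) (0, z)) := fun x z y => by
    rw [hc (y, 0), h₂₂₁, hc (0, z), hc (y, 0), add_comm]
  simp only [hb.add_left, hb.add_right, hm.add_left, hm.add_right, h₁₁₁, h₂₁₁, h₁₁₂, h₁₂₂, h₂₂₁,
    h₂₂₂, h₁₂₁, h₂₁₂]
  abel

section Bundled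
variable (br1 m1 : A1 →ₗ[F] A1 →ₗ[F] A1) (br2 m2 : A2 →ₗ[F] A2 →ₗ[F] A2)
  (ρ1 μ1 : A1 →ₗ[F] Module.End F A2) (ρ2 μ2 : A2 →ₗ[F] Module.End F A1)

theorem isBilin_prodBr : IsBilin F (prodBr F (br1 · ·) (br2 · ·) ρ1 ρ2) := by
  constructor <;> intro u <;> constructor <;> intros <;> ext <;>
    simp [prodBr, smul_add, smul_sub] <;> abel

theorem isBilin_prodMul : IsBilin F (prodMul F (m1 · ·) (m2 · ·) μ1 μ2) := by
  constructor <;> intro u <;> constructor <;> intros <;> ext <;>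
    simp [prodMul, smul_add] <;> abel

theorem isSkew_prodBr {br1 : A1 → A1 → A1} {br2 : A2 → A2 → A2} (h1 : IsSkew br1)
    (h2 : IsSkew br2) (ρ1 : A1 → Module.End F A2) (ρ2 : A2 → Module.End F A1) :
    IsSkew (prodBr F br1 br2 ρ1 ρ2) := by
  intro u v
  ext
  · simp only [prodBr, h1 u.1, Prod.fst_neg]; abel
  · simp only [prodBr, h2 u.2, Prod.snd_neg]; abel

theorem prodMul_comm {m1 : A1 → A1 → A1} {m2 : A2 → A2 → A2} (h1 : ∀ x y, m1 x y = m1 y x)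
    (h2 : ∀ x y, m2 x y = m2 y x) (μ1 : A1 → Module.End F A2) (μ2 : A2 → Module.End F A1)
    (u v : A1 × A2) : prodMul F m1 m2 μ1 μ2 u v = prodMul F m1 m2 μ1 μ2 v u := by
  ext
  · simp only [prodMul, h1 u.1]; abel
  · simp only [prodMul, h2 u.2]; abel

theorem sagleDefect_prodBr_swap (u v w t : A1 × A2) :
    sagleDefect (prodBr F (br2 · ·) (br1 · ·) ρ2 ρ1) u.swap v.swap w.swap t.swap =
      (sagleDefect (prodBr F (br1 · ·) (br2 · ·) ρ1 ρ2) u v w t).swap := rfl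

theorem sagleDefect_prodBr_three_one (x y z : A1) (t : A2) :
    sagleDefect (prodBr F (br1 · ·) (br2 · ·) ρ1 ρ2) (x, 0) (y, 0) (z, 0) (0, t) =
      (br1 (br1 (ρ2 t x) y) z - br1 (ρ2 t (br1 y z)) x - br1 (ρ2 (ρ1 x t) y) z
      - br1 (br1 (ρ2 t z) x) y + ρ2 (ρ1 y (ρ1 x t)) z + br1 (br1 x z) (ρ2 t y)
      - ρ2 t (br1 (br1 x y) z) + ρ2 (ρ1 y t) (br1 x z) + br1 (ρ2 (ρ1 z t) x) y
      + ρ2 (ρ1 (br1 y z) t) x - ρ2 (ρ1 x (ρ1 z t)) y,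
      ρ1 (br1 (br1 x y) z) t - (ρ1 z * ρ1 y * ρ1 x - ρ1 y * ρ1 x * ρ1 z
        + ρ1 x * ρ1 (br1 y z) + ρ1 (br1 x z) * ρ1 y) t) := by
  ext <;> simp [sagleDefect, prodBr] <;> abel

theorem fst_sagleDefect_prodBr_two_two (x1 y1 : A1) (x2 y2 : A2) :
    (sagleDefect (prodBr F (br1 · ·) (br2 · ·) ρ1 ρ2) (x1, 0) (y1, 0) (0, x2) (0, y2)).1 =
      -(ρ2 (ρ1 x1 (br2 x2 y2)) y1 - ρ2 (ρ1 x1 x2) (ρ2 y2 y1) + ρ2 x2 (br1 (ρ2 y2 x1) y1)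
      - br1 (ρ2 y2 (ρ2 x2 y1)) x1 - br1 (ρ2 (br2 x2 y2) x1) y1 + ρ2 (ρ1 y1 y2) (ρ2 x2 x1)
      - ρ2 (br2 (ρ1 y1 x2) y2) x1 - ρ2 y2 (ρ2 x2 (br1 x1 y1)) + br1 (ρ2 x2 x1) (ρ2 y2 y1)
      - ρ2 x2 (ρ2 (ρ1 x1 y2) y1) + ρ2 (ρ1 (ρ2 x2 y1) y2) x1) := by
  simp [sagleDefect, prodBr]
  abel

theorem fst_sagleDefect_prodBr_alternating (x1 y1 : A1) (x2 y2 : A2) :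
    (sagleDefect (prodBr F (br1 · ·) (br2 · ·) ρ1 ρ2) (x1, 0) (0, x2) (y1, 0) (0, y2)).1 =
      ρ2 x2 (br1 (ρ2 y2 y1) x1) - ρ2 (br2 (ρ1 x1 y2) x2) y1 - br1 (ρ2 x2 (ρ2 y2 x1)) y1
      + ρ2 y2 (br1 (ρ2 x2 x1) y1) - br1 (ρ2 y2 (ρ2 x2 y1)) x1 - ρ2 (br2 (ρ1 y1 x2) y2) x1
      - ρ2 y2 (ρ2 (ρ1 x1 x2) y1) - ρ2 x2 (ρ2 (ρ1 y1 y2) x1) + ρ2 (br2 x2 y2) (br1 x1 y1)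
      + ρ2 (ρ1 (ρ2 x2 y1) y2) x1 + ρ2 (ρ1 (ρ2 y2 x1) x2) y1 := by
  simp [sagleDefect, prodBr]
  abel

/-- A representation together with one half of the Malcev compatibility conditions amounts to the
vanishing of components of the Sagle defect of the direct sum. -/
theorem malcevRepMap_and_compatHalf_iff :
    (IsMalcevRepMap F (br1 · ·) ρ1 ∧ MalcevCompatHalf F (br1 · ·) (br2 · ·) ρ1 ρ2) ↔
      (∀ (x y z : A1) (t : A2),
        sagleDefect (prodBr F (br1 · ·) (br2 · ·) ρ1 ρ2) (x, 0) (y, 0) (z, 0) (0, t) = 0) ∧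
      (∀ (x y : A1) (z t : A2),
        (sagleDefect (prodBr F (br1 · ·) (br2 · ·) ρ1 ρ2) (x, 0) (y, 0) (0, z) (0, t)).1 = 0) ∧
      (∀ (x y : A1) (z t : A2),
        (sagleDefect (prodBr F (br1 · ·) (br2 · ·) ρ1 ρ2) (x, 0) (0, z) (y, 0) (0, t)).1 = 0) := by
  simp only [sagleDefect_prodBr_three_one, fst_sagleDefect_prodBr_two_two, neg_eq_zero,
    fst_sagleDefect_prodBr_alternating, Prod.mk_eq_zero, forall_and, IsMalcevRepMap,
    MalcevCompatHalf, LinearMap.ext_iff, sub_eq_zero]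
  tauto

theorem isMalcev_prodBr_iff (h1 : IsMalcev F (br1 · ·)) (h2 : IsMalcev F (br2 · ·)) :
    IsMalcev F (prodBr F (br1 · ·) (br2 · ·) ρ1 ρ2) ↔
      IsMatchedPairMalcev F (br1 · ·) (br2 · ·) ρ1 ρ2 := by
  have hb := isBilin_prodBr br1 br2 ρ1 ρ2
  have hs := isSkew_prodBr h1.2.1 h2.2.1 ρ1 ρ2
  have rot := sagleDefect_rotate hb hs
  have e1 := malcevRepMap_and_compatHalf_iff br1 br2 ρ1 ρ2
  have e2 := malcevRepMap_and_compatHalf_iff br2 br1 ρ2 ρ1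
  have swap := sagleDefect_prodBr_swap br1 br2 ρ1 ρ2
  have lin1 : IsLinearMap F ρ1 := ρ1.isLinear
  have lin2 : IsLinearMap F ρ2 := ρ2.isLinear
  constructor
  · rintro ⟨-, -, h⟩
    rw [sagleIdentity_iff_sagleDefect] at h
    have h' : ∀ u v w t : A1 × A2, sagleDefect (prodBr F (br2 · ·) (br1 · ·) ρ2 ρ1)
        u.swap v.swap w.swap t.swap = 0 := fun u v w t => by rw [swap, h]; rfl
    have r1 := e1.2 ⟨fun _ _ _ _ => h .., fun _ _ _ _ => by rw [h]; rfl,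
      fun _ _ _ _ => by rw [h]; rfl⟩
    have r2 := e2.2 ⟨fun x y z t => h' (0, x) (0, y) (0, z) (t, 0),
      fun x y z t => congrArg Prod.fst (h' (0, x) (0, y) (z, 0) (t, 0)),
      fun x y z t => congrArg Prod.fst (h' (0, x) (z, 0) (0, y) (t, 0))⟩
    exact ⟨h1, h2, ⟨lin1, r1.1⟩, ⟨lin2, r2.1⟩, r1.2, r2.2⟩
  · rintro ⟨-, -, r1, r2, c1, c2⟩
    obtain ⟨a1, b1, d1⟩ := e1.1 ⟨r1.2, c1⟩
    obtain ⟨a2, b2, d2⟩ := e2.1 ⟨r2.2, c2⟩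
    refine ⟨hb, hs, sagleIdentity_prod hb hs ?_ a1 ?_ ?_ ?_ ?_⟩
    · intro x y z t
      have := sagleIdentity_iff_sagleDefect.1 h1.2.2 x y z t
      ext
      · simpa [sagleDefect, prodBr] using this
      · simp [sagleDefect, prodBr]
    · intro x y z t
      refine Prod.ext (b1 x y z t) ?_
      rw [← rot, ← rot]
      exact b2 z t x y
    · intro x y z t
      refine Prod.ext (d1 x y z t) ?_
      rw [← rot]
      exact d2 z t y x
    · intro x y z t
      rw [← rot]
      exact congrArg Prod.swap (a2 y z t x)
    · intro x y z t
      have := sagleIdentity_iff_sagleDefect.1 h2.2.2 x y z t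
      ext
      · simp [sagleDefect, prodBr]
      · simpa [sagleDefect, prodBr] using this

theorem isCommAssoc_prodMul_iff (h1 : IsCommAssoc F (m1 · ·)) (h2 : IsCommAssoc F (m2 · ·)) :
    IsCommAssoc F (prodMul F (m1 · ·) (m2 · ·) μ1 μ2) ↔
      IsMatchedPairComm F (m1 · ·) (m2 · ·) μ1 μ2 := by
  have hb := isBilin_prodMul m1 m2 μ1 μ2
  have hc := prodMul_comm h1.2.1 h2.2.1 μ1 μ2
  have c1 : ∀ x y, m1 x y = m1 y x := h1.2.1
  have c2 : ∀ x y, m2 x y = m2 y x := h2.2.1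
  constructor
  · rintro ⟨-, -, h⟩
    refine ⟨h1, h2, ⟨μ1.isLinear, fun x y => LinearMap.ext fun v => ?_⟩,
      ⟨μ2.isLinear, fun x y => LinearMap.ext fun v => ?_⟩, fun x a b => ?_, fun a x y => ?_⟩
    · simpa [prodMul] using congrArg Prod.snd (h (x, 0) (y, 0) (0, v))
    · simpa [prodMul] using congrArg Prod.fst (h (0, x) (0, y) (v, 0))
    · have := congrArg Prod.snd (h (x, 0) (0, a) (0, b))
      simp [prodMul] at this
      exact this.symm
    · have := congrArg Prod.fst (h (0, a) (x, 0) (y, 0))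
      simp [prodMul] at this
      exact this.symm
  · rintro ⟨-, -, r1, r2, e1, e2⟩
    refine ⟨hb, hc, assoc_prod hb hc ?_ ?_ ?_ ?_⟩
    · intro x y z
      simpa [prodMul] using h1.2.2 x y z
    · intro x y z
      ext
      · simp [prodMul, c1 x y, c1 x, e2]
      · simp [prodMul, r1.2 x y]
    · intro x y z
      ext
      · simp [prodMul, r2.2 x y]
      · simp [prodMul, c2 x y, c2 x, e1]
    · intro x y z
      simpa [prodMul] using h2.2.2 x y z

theorem isMalcevPoisson_prod_iff (h1 : IsMalcevPoisson F (br1 · ·) (m1 · ·))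
    (h2 : IsMalcevPoisson F (br2 · ·) (m2 · ·)) :
    IsMalcevPoisson F (prodBr F (br1 · ·) (br2 · ·) ρ1 ρ2) (prodMul F (m1 · ·) (m2 · ·) μ1 μ2) ↔
      IsMatchedPairMP F (br1 · ·) (m1 · ·) (br2 · ·) (m2 · ·) ρ1 μ1 ρ2 μ2 := by
  have eM := isMalcev_prodBr_iff br1 br2 ρ1 ρ2 h1.1 h2.1
  have eC := isCommAssoc_prodMul_iff m1 m2 μ1 μ2 h1.2.1 h2.2.1
  have c1 : ∀ x y, m1 x y = m1 y x := h1.2.1.2.1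
  have c2 : ∀ x y, m2 x y = m2 y x := h2.2.1.2.1
  constructor
  · rintro ⟨hM, hC, h⟩
    have M := eM.1 hM
    have C := eC.1 hC
    refine ⟨M, C, ⟨M.2.2.1, C.2.2.1, fun x y => ?_, fun x y => ?_⟩,
      ⟨M.2.2.2.1, C.2.2.2.1, fun x y => ?_, fun x y => ?_⟩,
      fun a x y => ?_, fun x a b => ?_, fun x y a => ?_, fun a b x => ?_⟩
    · ext v
      have := congrArg Prod.snd (h (0, v) (x, 0) (y, 0))
      simp [prodBr, prodMul] at this ⊢
      linear_combination (norm := module) -this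
    · ext v
      have := congrArg Prod.snd (h (x, 0) (y, 0) (0, v))
      simp [prodBr, prodMul] at this ⊢
      linear_combination (norm := module) -this
    · ext v
      have := congrArg Prod.fst (h (v, 0) (0, x) (0, y))
      simp [prodBr, prodMul] at this ⊢
      linear_combination (norm := module) -this
    · ext v
      have := congrArg Prod.fst (h (0, x) (0, y) (v, 0))
      simp [prodBr, prodMul] at this ⊢
      linear_combination (norm := module) -this
    · have := congrArg Prod.fst (h (0, a) (x, 0) (y, 0))
      simp [prodBr, prodMul] at this ⊢
      linear_combination (norm := module) this
    · have := congrArg Prod.snd (h (x, 0) (0, a) (0, b))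
      simp [prodBr, prodMul] at this ⊢
      linear_combination (norm := module) this
    · have := congrArg Prod.fst (h (x, 0) (y, 0) (0, a))
      simp [prodBr, prodMul, c1 y] at this ⊢
      linear_combination (norm := module) this
    · have := congrArg Prod.snd (h (0, a) (0, b) (x, 0))
      simp [prodBr, prodMul, c2 b] at this ⊢
      linear_combination (norm := module) this
  · rintro ⟨M, C, r1, r2, e1, e2, f1, f2⟩
    have hM := eM.2 M
    have hC := eC.2 C
    have p1 := fun x y v => LinearMap.congr_fun (r1.2.2.1 x y) v
    have q1 := fun x y v => LinearMap.congr_fun (r1.2.2.2 x y) v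
    have p2 := fun x y v => LinearMap.congr_fun (r2.2.2.1 x y) v
    have q2 := fun x y v => LinearMap.congr_fun (r2.2.2.2 x y) v
    simp at p1 q1 p2 q2
    refine ⟨hM, hC, leibniz_prod hM.1 hC.1 hC.2.1 ?_ ?_ ?_ ?_ ?_ ?_⟩
    · intro x y z
      simpa [prodBr, prodMul] using h1.2.2 x y z
    · intro x y z
      ext
      · have := e1 x y z
        simp [prodBr, prodMul] at this ⊢
        linear_combination (norm := module) this
      · simp [prodBr, prodMul, p1]
        abel
    · intro x y z
      ext
      · have := f1 x y z
        simp [prodBr, prodMul, c1 y] at this ⊢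
        linear_combination (norm := module) this
      · simp [prodBr, prodMul, q1]
    · intro x y z
      ext
      · simp [prodBr, prodMul, p2]
        abel
      · have := e2 x y z
        simp [prodBr, prodMul] at this ⊢
        linear_combination (norm := module) this
    · intro x y z
      ext
      · simp [prodBr, prodMul, q2]
      · have := f2 x y z
        simp [prodBr, prodMul, c2 y] at this ⊢
        linear_combination (norm := module) this
    · intro x y z
      simpa [prodBr, prodMul] using h2.2.2 x y z

end Bundled
end DirectSum

section Dual
variable {F : Type*} [Field F] {A : Type*} [AddCommGroup A] [Module F A]

theorem eq_of_forall_dual_apply_eq {x y : A} (h : ∀ η : Module.Dual F A, η x = η y) : x = y :=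
  sub_eq_zero.1 ((Module.forall_dual_apply_eq_zero_iff F _).1 fun η => by
    rw [map_sub, h, sub_self])

/-- An operation on `A ⊕ A*` that is commutative or anticommutative and for which the standard
pairing is invariant is determined by its restrictions to `A` and `A*`. -/
theorem eq_of_invariant {Op Op' : A × Module.Dual F A → A × Module.Dual F A → A × Module.Dual F A}
    (hb : IsBilin F Op) (hb' : IsBilin F Op') (ε : F)
    (hc : ∀ u v, Op u v = ε • Op v u) (hc' : ∀ u v, Op' u v = ε • Op' v u)
    (hA : ∀ x y : A, Op (x, 0) (y, 0) = Op' (x, 0) (y, 0))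
    (hS : ∀ ξ η : Module.Dual F A, Op (0, ξ) (0, η) = Op' (0, ξ) (0, η))
    (hi : ∀ u v w, w.2 (Op u v).1 + (Op u v).2 w.1 = (Op v w).2 u.1 + u.2 (Op v w).1)
    (hi' : ∀ u v w, w.2 (Op' u v).1 + (Op' u v).2 w.1 = (Op' v w).2 u.1 + u.2 (Op' v w).1) :
    Op = Op' := by
  have left : ∀ (x : A) (ξ : Module.Dual F A), Op (0, ξ) (x, 0) = Op' (0, ξ) (x, 0) := by
    intro x ξ
    refine Prod.ext (eq_of_forall_dual_apply_eq (F := F) fun η => ?_) (LinearMap.ext fun y => ?_)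
    · have h := hi (x, 0) (0, ξ) (0, η)
      have h' := hi' (x, 0) (0, ξ) (0, η)
      rw [hS] at h
      rw [hc, hc']
      have e := h.trans h'.symm
      simp only [map_zero, add_zero] at e
      simp [e]
    · have h := hi (0, ξ) (x, 0) (y, 0)
      have h' := hi' (0, ξ) (x, 0) (y, 0)
      rw [hA] at h
      simpa using h.trans h'.symm
  have right : ∀ (x : A) (ξ : Module.Dual F A), Op (x, 0) (0, ξ) = Op' (x, 0) (0, ξ) :=
    fun x ξ => by rw [hc, hc', left]
  funext u v
  rw [← Prod.fst_add_snd u, ← Prod.fst_add_snd v]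
  simp only [hb.add_left, hb.add_right, hb'.add_left, hb'.add_right, hA, hS, left, right]

theorem isLinearMap_dualRepNeg {br : A → A → A} (h : IsBilin F br) :
    IsLinearMap F (dualRepNeg F (mkEnd F br h)) where
  map_add x y := by
    ext ξ z
    simp [dualRepNeg, mkEnd, h.add_left, add_comm]
  map_smul c x := by
    ext ξ z
    simp [dualRepNeg, mkEnd, (h.2 z).map_smul c x]

theorem isLinearMap_dualRepPos {m : A → A → A} (h : IsBilin F m) :
    IsLinearMap F (dualRepPos F (mkEnd F m h)) where
  map_add x y := by
    ext ξ z
    simp [dualRepPos, mkEnd, h.add_left]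
  map_smul c x := by
    ext ξ z
    simp [dualRepPos, mkEnd, (h.2 z).map_smul c x]

variable [Module.IsReflexive F A]

theorem apply_coadjDouble {brS : Module.Dual F A → Module.Dual F A → Module.Dual F A}
    (h : IsBilin F brS) (ξ η : Module.Dual F A) (x : A) :
    η (coadjDouble F brS h ξ x) = -brS ξ η x := by
  simp [coadjDouble]

theorem apply_comulDouble {mS : Module.Dual F A → Module.Dual F A → Module.Dual F A}
    (h : IsBilin F mS) (ξ η : Module.Dual F A) (x : A) :
    η (comulDouble F mS h ξ x) = mS ξ η x := by
  simp [comulDouble]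

theorem isLinearMap_coadjDouble {brS : Module.Dual F A → Module.Dual F A → Module.Dual F A}
    (h : IsBilin F brS) : IsLinearMap F (coadjDouble F brS h) where
  map_add ξ ζ := LinearMap.ext fun x => eq_of_forall_dual_apply_eq (F := F) fun η => by
    simp [apply_coadjDouble, h.add_left, add_comm]
  map_smul c ξ := LinearMap.ext fun x => eq_of_forall_dual_apply_eq (F := F) fun η => by
    simp [apply_coadjDouble, (h.2 η).map_smul c ξ]

theorem isLinearMap_comulDouble {mS : Module.Dual F A → Module.Dual F A → Module.Dual F A}
    (h : IsBilin F mS) : IsLinearMap F (comulDouble F mS h) where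
  map_add ξ ζ := LinearMap.ext fun x => eq_of_forall_dual_apply_eq (F := F) fun η => by
    simp [apply_comulDouble, h.add_left]
  map_smul c ξ := LinearMap.ext fun x => eq_of_forall_dual_apply_eq (F := F) fun η => by
    simp [apply_comulDouble, (h.2 η).map_smul c ξ]

theorem prodBr_invariant {br : A → A → A}
    {brS : Module.Dual F A → Module.Dual F A → Module.Dual F A} (h : IsBilin F br)
    (hS : IsBilin F brS) (hs : IsSkew br) (hsS : IsSkew brS) (u v w : A × Module.Dual F A) :
    let Br := prodBr F br brS (dualRepNeg F (mkEnd F br h)) (coadjDouble F brS hS)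
    w.2 (Br u v).1 + (Br u v).2 w.1 = (Br v w).2 u.1 + u.2 (Br v w).1 := by
  simp only [prodBr, map_add, map_sub, apply_coadjDouble, LinearMap.add_apply,
    LinearMap.sub_apply, dualRepNeg, mkEnd, LinearMap.neg_apply, LinearMap.dualMap_apply,
    IsLinearMap.mk'_apply]
  rw [hs v.1 u.1, hs w.1 u.1, hsS v.2 u.2, hsS w.2 u.2]
  simp only [map_neg, LinearMap.neg_apply]
  ring

theorem prodMul_invariant {m : A → A → A}
    {mS : Module.Dual F A → Module.Dual F A → Module.Dual F A} (h : IsBilin F m)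
    (hS : IsBilin F mS) (hc : ∀ x y, m x y = m y x) (hcS : ∀ ξ η, mS ξ η = mS η ξ)
    (u v w : A × Module.Dual F A) :
    let Mul := prodMul F m mS (dualRepPos F (mkEnd F m h)) (comulDouble F mS hS)
    w.2 (Mul u v).1 + (Mul u v).2 w.1 = (Mul v w).2 u.1 + u.2 (Mul v w).1 := by
  simp only [prodMul, map_add, apply_comulDouble, LinearMap.add_apply, dualRepPos, mkEnd,
    LinearMap.dualMap_apply, IsLinearMap.mk'_apply]
  rw [hc v.1 u.1, hc w.1 u.1, hcS v.2 u.2, hcS w.2 u.2]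
  ring

end Dual

/-- There is a Malcev-Poisson algebra structure on `A ⊕ A*` extending the
given structures on `A` and `A*` and making the standard bilinear form
`ω_d(x+ξ, y+η) = η(x) + ξ(y)` invariant for both operations, iff
`(A, A*, ad*_A, −L*, ad*_{A*}, −L*_{A*})` is a matched pair of Malcev-Poisson algebras. -/
theorem maninTriple_iff_matchedPair_malcevPoisson
    {A : Type*} [AddCommGroup A] [Module K A] [FiniteDimensional K A]
    (br m : A → A → A) (hA : IsMalcevPoisson K br m)
    (brS mS : Module.Dual K A → Module.Dual K A → Module.Dual K A)
    (hS : IsMalcevPoisson K brS mS) :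
    (∃ Br Mul : A × Module.Dual K A → A × Module.Dual K A → A × Module.Dual K A,
        IsMalcevPoisson K Br Mul ∧
        (∀ x y : A, Br (x, 0) (y, 0) = (br x y, 0)) ∧
        (∀ x y : A, Mul (x, 0) (y, 0) = (m x y, 0)) ∧
        (∀ ξ η : Module.Dual K A, Br (0, ξ) (0, η) = (0, brS ξ η)) ∧
        (∀ ξ η : Module.Dual K A, Mul (0, ξ) (0, η) = (0, mS ξ η)) ∧
        (∀ u v w : A × Module.Dual K A,
          w.2 (Br u v).1 + (Br u v).2 w.1 = (Br v w).2 u.1 + u.2 (Br v w).1) ∧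
        (∀ u v w : A × Module.Dual K A,
          w.2 (Mul u v).1 + (Mul u v).2 w.1 = (Mul v w).2 u.1 + u.2 (Mul v w).1)) ↔
      IsMatchedPairMP K br m brS mS
        (dualRepNeg K (mkEnd K br hA.1.1)) (dualRepPos K (mkEnd K m hA.2.1.1))
        (coadjDouble K brS hS.1.1) (comulDouble K mS hS.2.1.1) := by
  set ρ1 := dualRepNeg K (mkEnd K br hA.1.1)
  set μ1 := dualRepPos K (mkEnd K m hA.2.1.1)
  set ρ2 := coadjDouble K brS hS.1.1
  set μ2 := comulDouble K mS hS.2.1.1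
  have key : IsMalcevPoisson K (prodBr K br brS ρ1 ρ2) (prodMul K m mS μ1 μ2) ↔
      IsMatchedPairMP K br m brS mS ρ1 μ1 ρ2 μ2 :=
    isMalcevPoisson_prod_iff (mkBilin K br hA.1.1) (mkBilin K m hA.2.1.1)
      (mkBilin K brS hS.1.1) (mkBilin K mS hS.2.1.1)
      ((isLinearMap_dualRepNeg hA.1.1).mk' _) ((isLinearMap_dualRepPos hA.2.1.1).mk' _)
      ((isLinearMap_coadjDouble hS.1.1).mk' _) ((isLinearMap_comulDouble hS.2.1.1).mk' _) hA hS
  have hbBr : IsBilin K (prodBr K br brS ρ1 ρ2) :=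
    isBilin_prodBr (mkBilin K br hA.1.1) (mkBilin K brS hS.1.1)
      ((isLinearMap_dualRepNeg hA.1.1).mk' _) ((isLinearMap_coadjDouble hS.1.1).mk' _)
  have hbMul : IsBilin K (prodMul K m mS μ1 μ2) :=
    isBilin_prodMul (mkBilin K m hA.2.1.1) (mkBilin K mS hS.2.1.1)
      ((isLinearMap_dualRepPos hA.2.1.1).mk' _) ((isLinearMap_comulDouble hS.2.1.1).mk' _)
  have hρ1 : ρ1 0 = 0 := (isLinearMap_dualRepNeg hA.1.1).map_zero
  have hμ1 : μ1 0 = 0 := (isLinearMap_dualRepPos hA.2.1.1).map_zero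
  have hρ2 : ρ2 0 = 0 := (isLinearMap_coadjDouble hS.1.1).map_zero
  have hμ2 : μ2 0 = 0 := (isLinearMap_comulDouble hS.2.1.1).map_zero
  have brA : ∀ x y : A, prodBr K br brS ρ1 ρ2 (x, 0) (y, 0) = (br x y, 0) := fun x y => by
    simp [prodBr, hρ2, (hS.1.1.1 0).map_zero]
  have mulA : ∀ x y : A, prodMul K m mS μ1 μ2 (x, 0) (y, 0) = (m x y, 0) := fun x y => by
    simp [prodMul, hμ2, (hS.2.1.1.1 0).map_zero]
  have brD : ∀ ξ η : Module.Dual K A,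
      prodBr K br brS ρ1 ρ2 (0, ξ) (0, η) = (0, brS ξ η) := fun ξ η => by
    simp [prodBr, hρ1, (hA.1.1.1 0).map_zero]
  have mulD : ∀ ξ η : Module.Dual K A,
      prodMul K m mS μ1 μ2 (0, ξ) (0, η) = (0, mS ξ η) := fun ξ η => by
    simp [prodMul, hμ1, (hA.2.1.1.1 0).map_zero]
  have invBr := prodBr_invariant hA.1.1 hS.1.1 hA.1.2.1 hS.1.2.1
  have invMul := prodMul_invariant hA.2.1.1 hS.2.1.1 hA.2.1.2.1 hS.2.1.2.1
  constructor
  · rintro ⟨Br, Mul, h, hBrA, hMulA, hBrD, hMulD, hiBr, hiMul⟩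
    have eBr : Br = prodBr K br brS ρ1 ρ2 := by
      refine eq_of_invariant h.1.1 hbBr (-1) (fun u v => ?_) (fun u v => ?_)
        (fun x y => by rw [hBrA, brA]) (fun ξ η => by rw [hBrD, brD]) hiBr invBr
      · exact (h.1.2.1 u v).trans (neg_one_smul K _).symm
      · exact (isSkew_prodBr hA.1.2.1 hS.1.2.1 ρ1 ρ2 u v).trans (neg_one_smul K _).symm
    have eMul : Mul = prodMul K m mS μ1 μ2 := by
      refine eq_of_invariant h.2.1.1 hbMul 1 (fun u v => ?_) (fun u v => ?_)
        (fun x y => by rw [hMulA, mulA]) (fun ξ η => by rw [hMulD, mulD]) hiMul invMul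
      · rw [one_smul]; exact h.2.1.2.1 u v
      · rw [one_smul]; exact prodMul_comm hA.2.1.2.1 hS.2.1.2.1 μ1 μ2 u v
    exact key.1 (eBr ▸ eMul ▸ h)
  · exact fun h => ⟨_, _, key.2 h, brA, mulA, brD, mulD, invBr, invMul⟩

end MPA
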